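/- arXiv:2009.11643 — 2 statements merged into one kernel-verified Lean document; each statement's English description precedes it below -/
import Mathlib

section
/- Let j ∈ ℕ, let α₁ and α₂ be MD strategies, let a ∈ L and let w ∈ L* be a word of length at most j. Define the MD strategy α by α(i) = α₁(i) if c_i ∉ V₁^j and α(i) = α₂(i) otherwise. Then M_{α₁}(a)·M_{α₂}(w)·1 lies in the linear span of V₁^j ∪ {M_α(aw)·1}. -/
open Matrix

/-- A labelled Markov decision process: a partial probabilistic transition function
`phi : S × A ⇀ (S → ℝ)` and a labelling function. -/
structure MDP (S A L : Type) where
  phi : S → A → Option (S → ℝ)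
  label : S → L

namespace MDP

variable {S A L : Type} [Fintype S] [Fintype A] [DecidableEq S]

/-- The MDP data is well-formed: every state has an available action, and every
defined `phi s m` is a probability distribution on `S`. -/
def IsValid (D : MDP S A L) : Prop :=
  (∀ s, ∃ m, (D.phi s m).isSome) ∧
    ∀ s m d, D.phi s m = some d → (∀ t, 0 ≤ d t) ∧ (∑ t, d t) = 1

/-- Transition probabilities, with `0` for unavailable actions. -/
def trans (D : MDP S A L) (s : S) (m : A) : S → ℝ :=
  (D.phi s m).getD 0

/-- A memoryless strategy: for each state a probability distribution on the
available actions. -/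
def IsStrategy (D : MDP S A L) (α : S → A → ℝ) : Prop :=
  ∀ s, (∀ m, 0 ≤ α s m) ∧ (∑ m, α s m) = 1 ∧ ∀ m, D.phi s m = none → α s m = 0

/-- Transition probabilities of the induced labelled Markov chain `D(α)`. -/
def tau (D : MDP S A L) (α : S → A → ℝ) (s t : S) : ℝ :=
  ∑ m, α s m * D.trans s m t

/-- The matrix `M_α(a)`. -/
def Mmat [DecidableEq L] (D : MDP S A L) (α : S → A → ℝ) (a : L) : Matrix S S ℝ :=
  Matrix.of fun s t => if D.label s = a then D.tau α s t else 0

/-- The matrix `M_α(w)` for a word `w ∈ L*` (identity for the empty word). -/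
def Mword [DecidableEq L] (D : MDP S A L) (α : S → A → ℝ) (w : List L) : Matrix S S ℝ :=
  (w.map (D.Mmat α)).prod

/-- A memoryless deterministic (MD) strategy, viewed as a function `S → A`
choosing an available action in each state. -/
def IsMD (D : MDP S A L) (β : S → A) : Prop := ∀ s, (D.phi s (β s)).isSome

/-- The memoryless strategy corresponding to an MD strategy. -/
def mdStrat [DecidableEq A] (β : S → A) : S → A → ℝ :=
  fun s m => if m = β s then 1 else 0

end MDP

namespace MDP

variable {S A L : Type} [Fintype S] [Fintype A] [Fintype L]
  [DecidableEq S] [DecidableEq A] [DecidableEq L]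

/-- The column-vector space
`V₁^j = span{M_{α₁}(a₁)⋯M_{α_k}(a_k)·1 : k ≤ j, αᵢ memoryless strategies, aᵢ ∈ L}`. -/
def V1le (D : MDP S A L) (j : ℕ) : Submodule ℝ (S → ℝ) :=
  Submodule.span ℝ
    {v | ∃ k : ℕ, k ≤ j ∧ ∃ (αs : Fin k → S → A → ℝ) (as : Fin k → L),
      (∀ i, D.IsStrategy (αs i)) ∧
      v = ((List.ofFn fun i => D.Mmat (αs i) (as i)).prod).mulVec 1}

end MDP

namespace MDP

variable {S A L : Type} [Fintype S] [Fintype A] [Fintype L]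
  [DecidableEq S] [DecidableEq A] [DecidableEq L]

omit [Fintype S] [Fintype L] [DecidableEq S] [DecidableEq L] in
/-- The strategy induced by an MD strategy is a memoryless strategy. -/
theorem IsMD.isStrategy_mdStrat {D : MDP S A L} {σ : S → A} (hσ : D.IsMD σ) :
    D.IsStrategy (mdStrat σ) := by
  refine fun s => ⟨fun m => ?_, by simp [mdStrat], fun m hm => ?_⟩
  · unfold mdStrat
    split_ifs <;> simp
  · refine if_neg fun h => ?_
    have := hσ s
    simp [← h, hm] at this

omit [Fintype L] [DecidableEq S] in
/-- The `i`-th entry of `M_σ(b) x` depends on the MD strategy `σ` only through `σ i`. -/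
theorem mmat_mulVec_apply_congr (D : MDP S A L) {σ σ' : S → A} (b : L) (x : S → ℝ) {i : S}
    (h : σ i = σ' i) :
    (D.Mmat (mdStrat σ) b).mulVec x i = (D.Mmat (mdStrat σ') b).mulVec x i := by
  simp [Matrix.mulVec, dotProduct, Mmat, tau, mdStrat, h]

omit [Fintype L] [DecidableEq A] in
theorem mword_cons_mulVec (D : MDP S A L) (α : S → A → ℝ) (b : L) (w : List L) (x : S → ℝ) :
    (D.Mword α (b :: w)).mulVec x = (D.Mmat α b).mulVec ((D.Mword α w).mulVec x) := by
  simp [Mword, Matrix.mulVec_mulVec]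

omit [Fintype L] [DecidableEq A] in
theorem mmat_mword_mem_V1le (D : MDP S A L) {j : ℕ} {σ ρ : S → A → ℝ} (hσ : D.IsStrategy σ)
    (hρ : D.IsStrategy ρ) (b : L) {w : List L} (hw : w.length + 1 ≤ j) :
    (D.Mmat σ b).mulVec ((D.Mword ρ w).mulVec 1) ∈ D.V1le j := by
  refine Submodule.subset_span ⟨w.length + 1, hw, Fin.cons σ fun _ => ρ, Fin.cons b w.get, ?_, ?_⟩
  · exact Fin.cases hσ fun _ => hρ
  · have h : (List.ofFn fun i => D.Mmat ρ (w.get i)) = w.map (D.Mmat ρ) := by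
      conv_rhs => rw [← List.ofFn_get w, List.map_ofFn]
      rfl
    simp only [List.ofFn_succ, Fin.cons_zero, Fin.cons_succ, List.prod_cons, h,
      Matrix.mulVec_mulVec, Mword]

omit [Fintype L] in
/-- At a state `i` with `c_i ∉ V₁^j`, the choice of the first action does not matter for words of
length at most `j`. -/
theorem mmat_mword_apply_eq_of_single_notMem (D : MDP S A L) {j : ℕ} {σ ρ : S → A}
    (hσ : D.IsMD σ) (hρ : D.IsMD ρ) (b : L) {w : List L} (hw : w.length + 1 ≤ j) {i : S}
    (hi : Pi.single i (1 : ℝ) ∉ D.V1le j) :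
    (D.Mmat (mdStrat σ) b).mulVec ((D.Mword (mdStrat ρ) w).mulVec 1) i =
      (D.Mmat (mdStrat ρ) b).mulVec ((D.Mword (mdStrat ρ) w).mulVec 1) i := by
  set x := (D.Mword (mdStrat ρ) w).mulVec 1 with hx
  have hτ : D.IsMD (Function.update ρ i (σ i)) := fun s => by
    rcases eq_or_ne s i with rfl | hs
    · simpa using hσ s
    · simpa [hs] using hρ s
  set τ := Function.update ρ i (σ i) with hτ_def
  have hmem := sub_mem
    (D.mmat_mword_mem_V1le hτ.isStrategy_mdStrat hρ.isStrategy_mdStrat b hw)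
    (D.mmat_mword_mem_V1le hρ.isStrategy_mdStrat hρ.isStrategy_mdStrat b hw)
  rw [← hx] at hmem
  rw [D.mmat_mulVec_apply_congr (σ := σ) (σ' := τ) b x (by simp [hτ_def])]
  by_contra hne
  rw [← ne_eq, ← sub_ne_zero] at hne
  refine hi ((Submodule.smul_mem_iff _ hne).1 ?_)
  convert hmem using 1
  ext s
  rcases eq_or_ne s i with rfl | hs
  · simp
  · simp [hs, D.mmat_mulVec_apply_congr (σ := τ) (σ' := ρ) b x (i := s) (by simp [hτ_def, hs])]

omit [Fintype L] in
/-- Two MD strategies that agree on all states `i` with `c_i ∈ V₁^j` give the same vectors for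
words of length at most `j`. -/
theorem mword_mulVec_one_congr (D : MDP S A L) {j : ℕ} {σ ρ : S → A}
    (hσ : D.IsMD σ) (hρ : D.IsMD ρ) (h : ∀ i, Pi.single i (1 : ℝ) ∈ D.V1le j → σ i = ρ i)
    {w : List L} (hw : w.length ≤ j) :
    (D.Mword (mdStrat σ) w).mulVec 1 = (D.Mword (mdStrat ρ) w).mulVec 1 := by
  induction w with
  | nil => simp [Mword]
  | cons b w ih =>
    rw [List.length_cons] at hw
    rw [mword_cons_mulVec, mword_cons_mulVec, ih (by lia)]
    ext i
    by_cases hi : Pi.single i (1 : ℝ) ∈ D.V1le j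
    · exact D.mmat_mulVec_apply_congr b _ (h i hi)
    · exact D.mmat_mword_apply_eq_of_single_notMem hσ hρ b hw hi

/-- for MD strategies `β₁, β₂`, a label `a` and a word `w` of length at
most `j`, with `β` the MD strategy choosing `β₁ i` when `c_i ∉ V₁^j` and `β₂ i`
otherwise, the vector `M_{β₁}(a)·M_{β₂}(w)·1` lies in the span of
`V₁^j ∪ {M_β(aw)·1}`. -/
theorem mmat_mword_mem_sup
    (D : MDP S A L) (hD : D.IsValid) (j : ℕ)
    (β₁ β₂ : S → A) (h1 : D.IsMD β₁) (h2 : D.IsMD β₂)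
    (a : L) (w : List L) (hw : w.length ≤ j)
    (β : S → A)
    (hβ₁ : ∀ i, Pi.single i (1 : ℝ) ∉ D.V1le j → β i = β₁ i)
    (hβ₂ : ∀ i, Pi.single i (1 : ℝ) ∈ D.V1le j → β i = β₂ i) :
    (D.Mmat (mdStrat β₁) a).mulVec ((D.Mword (mdStrat β₂) w).mulVec 1) ∈
      D.V1le j ⊔ Submodule.span ℝ {(D.Mword (mdStrat β) (a :: w)).mulVec 1} := by
  have hβ : D.IsMD β := fun s => by
    by_cases hs : Pi.single s (1 : ℝ) ∈ D.V1le j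
    · exact hβ₂ s hs ▸ h2 s
    · exact hβ₁ s hs ▸ h1 s
  rw [mword_cons_mulVec, D.mword_mulVec_one_congr hβ h2 hβ₂ hw]
  set x := (D.Mword (mdStrat β₂) w).mulVec 1
  rw [← sub_add_cancel ((D.Mmat (mdStrat β₁) a).mulVec x) ((D.Mmat (mdStrat β) a).mulVec x)]
  refine Submodule.add_mem_sup ?_ (Submodule.mem_span_singleton_self _)
  rw [pi_eq_sum_univ' ((D.Mmat (mdStrat β₁) a).mulVec x - (D.Mmat (mdStrat β) a).mulVec x)]
  refine Submodule.sum_mem _ fun i _ => ?_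
  by_cases hi : Pi.single i (1 : ℝ) ∈ D.V1le j
  · convert Submodule.smul_mem _ _ hi using 2
  · simp [D.mmat_mulVec_apply_congr a x (hβ₁ i hi)]

end MDP
end

section
/- For every i ∈ ℕ with i ≤ |S| there exists a partial memoryless strategy α'_i such that for every memoryless strategy α compatible with α'_i, the relation ∼^i_{D(α)} is contained in ≡_{X_i}, where X₀ = {S} and X_{i+1} = S/≡_{X_i} is the partition-refinement sequence. -/
open Matrix

namespace MDP

variable {S A L : Type} [Fintype S] [Fintype A] [DecidableEq S]

open Classical in
/-- `φ(s,m)(E)`: the transition probability from `s` to the set `E ⊆ S` under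
action `m`. -/
noncomputable def phiE (D : MDP S A L) (s : S) (m : A) (E : Set S) : ℝ :=
  ∑ t, if t ∈ E then D.trans s m t else 0

/-- `φ(s,m)(X)`: the vector `(φ(s,m)(E))_{E ∈ X}` over a partition `X`. -/
noncomputable def phiVec (D : MDP S A L) (X : Set (Set S)) (s : S) (m : A) : X → ℝ :=
  fun E => D.phiE s m E.1

/-- `φ(s)(X) = {φ(s,m)(X) : m ∈ A(s)}`. -/
def phiSet (D : MDP S A L) (X : Set (Set S)) (s : S) : Set (X → ℝ) :=
  {v | ∃ m, (D.phi s m).isSome ∧ v = D.phiVec X s m}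

/-- The equivalence relation `≡_X` associated with a partition `X`:
`s ≡_X s'` iff `ℓ(s) = ℓ(s')`, and if `s ≠ s'` then `|φ(s)(X)| = 1` and
`φ(s)(X) = φ(s')(X)`. -/
def equivX (D : MDP S A L) (X : Set (Set S)) (s s' : S) : Prop :=
  D.label s = D.label s' ∧
    (s ≠ s' → (∃ v, D.phiSet X s = {v}) ∧ D.phiSet X s = D.phiSet X s')

/-- The partition-refinement sequence: `X₀ = {S}` and `X_{i+1} = S/≡_{X_i}`. -/
def partseq (D : MDP S A L) : ℕ → Set (Set S)
  | 0 => {Set.univ}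
  | i + 1 => {E | ∃ s, E = {t | D.equivX (D.partseq i) s t}}

end MDP

namespace MDP

variable {S A L : Type} [Fintype S] [Fintype A] [DecidableEq S]

open Classical in
/-- `τ(s)(E)`: the transition probability from `s` to the set `E ⊆ S` in the
labelled Markov chain `D(α)`. -/
noncomputable def tauE (D : MDP S A L) (α : S → A → ℝ) (s : S) (E : Set S) : ℝ :=
  ∑ t, if t ∈ E then D.tau α s t else 0

/-- `R` is a probabilistic bisimulation in the labelled Markov chain `D(α)`:
an equivalence relation relating only equally labelled states with equal
transition probabilities into every `R`-equivalence class. -/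
def IsProbBisim (D : MDP S A L) (α : S → A → ℝ) (R : S → S → Prop) : Prop :=
  Equivalence R ∧ ∀ s t, R s t →
    D.label s = D.label t ∧
      ∀ E : Set S, (∃ u, E = {v | R u v}) → D.tauE α s E = D.tauE α t E

/-- Probabilistic bisimilarity `∼_{D(α)}`: the largest probabilistic bisimulation,
i.e. `s ∼ t` iff some probabilistic bisimulation relates `s` and `t`. -/
def Bisimilar (D : MDP S A L) (α : S → A → ℝ) (s t : S) : Prop :=
  ∃ R, D.IsProbBisim α R ∧ R s t

end MDP

namespace MDP

variable {S A L : Type} [Fintype S] [Fintype A] [DecidableEq S]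

/-- A partial memoryless strategy: a partial function assigning to (some) states a
probability distribution on the available actions. -/
def IsPartialStrategy (D : MDP S A L) (α' : S → Option (A → ℝ)) : Prop :=
  ∀ s d, α' s = some d →
    (∀ m, 0 ≤ d m) ∧ (∑ m, d m) = 1 ∧ ∀ m, D.phi s m = none → d m = 0

/-- A memoryless strategy `α` is compatible with the partial memoryless strategy
`α'` (written `α ⊒ α'`). -/
def Compatible (α : S → A → ℝ) (α' : S → Option (A → ℝ)) : Prop :=
  ∀ s d, α' s = some d → α s = d

/-- The relations `∼^i_{D(α)}`: `s ∼⁰ t` iff `ℓ(s) = ℓ(t)`, and `s ∼^{i+1} t` iff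
moreover `τ(s)(E) = τ(t)(E)` for every `∼^i`-equivalence class `E`. -/
def simI (D : MDP S A L) (α : S → A → ℝ) : ℕ → S → S → Prop
  | 0 => fun s t => D.label s = D.label t
  | i + 1 => fun s t => D.label s = D.label t ∧
      ∀ E : Set S, (∃ u, E = {v | D.simI α i u v}) → D.tauE α s E = D.tauE α t E

/-- The weight of the available actions of `s` under `x`. -/
noncomputable def weight (D : MDP S A L) (x : S × A → ℝ) (s : S) : ℝ :=
  ∑ m, if (D.phi s m).isSome then x (s, m) else 0

/-- The memoryless strategy choosing available actions proportionally to the weights `x`. -/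
noncomputable def weightStrat (D : MDP S A L) (x : S × A → ℝ) (s : S) (m : A) : ℝ :=
  (if (D.phi s m).isSome then x (s, m) else 0) / D.weight x s

omit [DecidableEq S] in
lemma weight_pos {D : MDP S A L} (hD : D.IsValid) {x : S × A → ℝ} (hx : ∀ p, 0 < x p) (s : S) :
    0 < D.weight x s := by
  obtain ⟨m, hm⟩ := hD.1 s
  refine Finset.sum_pos' (fun m _ => ?_) ⟨m, Finset.mem_univ m, ?_⟩
  · split_ifs
    exacts [(hx _).le, le_rfl]
  · simpa [hm] using hx _

omit [DecidableEq S] in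
lemma isStrategy_weightStrat {D : MDP S A L} (hD : D.IsValid) {x : S × A → ℝ}
    (hx : ∀ p, 0 < x p) : D.IsStrategy (D.weightStrat x) := by
  refine fun s => ⟨fun m => ?_, ?_, fun m hm => ?_⟩
  · refine div_nonneg ?_ (weight_pos hD hx s).le
    split_ifs
    exacts [(hx _).le, le_rfl]
  · simp only [weightStrat, ← Finset.sum_div]
    exact div_self (weight_pos hD hx s).ne'
  · simp [weightStrat, hm]

omit [DecidableEq S] in
lemma tauE_eq_sum (D : MDP S A L) (α : S → A → ℝ) (s : S) (E : Set S) :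
    D.tauE α s E = ∑ m, α s m * D.phiE s m E := by
  simp only [tauE, tau, phiE, Finset.mul_sum]
  rw [Finset.sum_comm]
  refine Finset.sum_congr rfl fun t _ => ?_
  split_ifs <;> simp

omit [DecidableEq S] in
lemma tauE_eq_phiE {D : MDP S A L} {α : S → A → ℝ} (hα : D.IsStrategy α) {s : S} {E : Set S}
    {m : A} (h : ∀ m', (D.phi s m').isSome → D.phiE s m' E = D.phiE s m E) :
    D.tauE α s E = D.phiE s m E := by
  rw [tauE_eq_sum]
  calc ∑ m', α s m' * D.phiE s m' E = ∑ m', α s m' * D.phiE s m E := by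
        refine Finset.sum_congr rfl fun m' _ => ?_
        cases h' : D.phi s m' with
        | none => simp [(hα s).2.2 m' h']
        | some d => rw [h m' (by simp [h'])]
    _ = D.phiE s m E := by rw [← Finset.sum_mul, (hα s).2.1, one_mul]

omit [Fintype A] [DecidableEq S] in
lemma phiE_univ {D : MDP S A L} (hD : D.IsValid) {s : S} {m : A} (hm : (D.phi s m).isSome) :
    D.phiE s m Set.univ = 1 := by
  obtain ⟨d, hd⟩ := Option.isSome_iff_exists.1 hm
  simpa [phiE, trans, hd] using (hD.2 s m d hd).2

/-- A strategy is separating if, whenever the available actions of `s` differ in their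
probability of entering `E`, no other state enters `E` with the same probability as `s`. -/
def IsSeparating (D : MDP S A L) (α : S → A → ℝ) : Prop :=
  ∀ s t (E : Set S), s ≠ t → D.tauE α s E = D.tauE α t E →
    ∀ m m', (D.phi s m).isSome → (D.phi s m').isSome → D.phiE s m E = D.phiE s m' E

/-- The numerator of `τ(s)(E)` for a weight strategy, as a polynomial in the weights. -/
noncomputable def enterPoly (D : MDP S A L) (s : S) (E : Set S) : MvPolynomial (S × A) ℝ :=
  ∑ m, if (D.phi s m).isSome then MvPolynomial.C (D.phiE s m E) * MvPolynomial.X (s, m) else 0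

/-- The weight of `s`, as a polynomial in the weights. -/
noncomputable def weightPoly (D : MDP S A L) (s : S) : MvPolynomial (S × A) ℝ :=
  ∑ m, if (D.phi s m).isSome then MvPolynomial.X (s, m) else 0

omit [Fintype S] [DecidableEq S] in
lemma eval_weightPoly (D : MDP S A L) (x : S × A → ℝ) (s : S) :
    MvPolynomial.eval x (D.weightPoly s) = D.weight x s := by
  simp only [weightPoly, weight, map_sum]
  refine Finset.sum_congr rfl fun m _ => ?_
  split_ifs <;> simp

omit [DecidableEq S] in
lemma eval_enterPoly (D : MDP S A L) (x : S × A → ℝ) (s : S) (E : Set S) :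
    MvPolynomial.eval x (D.enterPoly s E) =
      ∑ m, if (D.phi s m).isSome then D.phiE s m E * x (s, m) else 0 := by
  simp only [enterPoly, map_sum]
  refine Finset.sum_congr rfl fun m _ => ?_
  split_ifs <;> simp

omit [DecidableEq S] in
lemma tauE_weightStrat (D : MDP S A L) (x : S × A → ℝ) (s : S) (E : Set S) :
    D.tauE (D.weightStrat x) s E =
      MvPolynomial.eval x (D.enterPoly s E) / D.weight x s := by
  rw [tauE_eq_sum, eval_enterPoly, Finset.sum_div]
  refine Finset.sum_congr rfl fun m _ => ?_
  unfold weightStrat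
  split_ifs <;> ring

/-- The numerator of `τ(s)(E) - τ(t)(E)` for a weight strategy. -/
noncomputable def diffPoly (D : MDP S A L) (s t : S) (E : Set S) : MvPolynomial (S × A) ℝ :=
  D.enterPoly s E * D.weightPoly t - D.enterPoly t E * D.weightPoly s

omit [DecidableEq S] in
lemma eval_diffPoly_eq_zero {D : MDP S A L} (hD : D.IsValid) {x : S × A → ℝ}
    (hx : ∀ p, 0 < x p) {s t : S} {E : Set S}
    (h : D.tauE (D.weightStrat x) s E = D.tauE (D.weightStrat x) t E) :
    MvPolynomial.eval x (D.diffPoly s t E) = 0 := by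
  rw [tauE_weightStrat, tauE_weightStrat,
    div_eq_div_iff (weight_pos hD hx s).ne' (weight_pos hD hx t).ne'] at h
  simp only [diffPoly, map_sub, map_mul, eval_weightPoly, h, sub_self]

open Classical in
lemma phiE_eq_of_diffPoly_eq_zero {D : MDP S A L} {s t : S} {E : Set S} (hst : s ≠ t)
    (h : D.diffPoly s t E = 0) {m m' : A} (hm : (D.phi s m).isSome) (hm' : (D.phi t m').isSome) :
    D.phiE s m E = D.phiE t m' E := by
  have := congrArg (MvPolynomial.eval fun p : S × A =>
    if p.1 = s then (if p.2 = m then (1 : ℝ) else 0) else if p.2 = m' then 1 else 0) h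
  simp only [diffPoly, map_sub, map_mul, eval_weightPoly, eval_enterPoly, weight, hst.symm,
    if_true, if_false, map_zero] at this
  rw [Finset.sum_eq_single m, Finset.sum_eq_single m', Finset.sum_eq_single m',
    Finset.sum_eq_single m] at this
  · simp only [hm, hm', if_true] at this
    linarith
  all_goals simp +contextual

lemma exists_isSeparating {D : MDP S A L} (hD : D.IsValid) :
    ∃ α, D.IsStrategy α ∧ D.IsSeparating α := by
  classical
  let P : MvPolynomial (S × A) ℝ := ∏ q : S × S × Set S,
    if D.diffPoly q.1 q.2.1 q.2.2 = 0 then 1 else D.diffPoly q.1 q.2.1 q.2.2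
  have hP : P ≠ 0 := by
    refine Finset.prod_ne_zero_iff.2 fun q _ => ?_
    split_ifs with h
    exacts [one_ne_zero, h]
  obtain ⟨x, hx, hPx⟩ : ∃ x : S × A → ℝ, (∀ p, 0 < x p) ∧ MvPolynomial.eval x P ≠ 0 := by
    by_contra! hcon
    exact hP (MvPolynomial.funext_set (fun _ => Set.Ioi 0) (fun _ => Set.Ioi_infinite 0)
      fun x hx => by simpa using hcon x fun p => hx p (Set.mem_univ p))
  refine ⟨D.weightStrat x, isStrategy_weightStrat hD hx, fun s t E hst h m m' hm hm' => ?_⟩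
  have hzero : D.diffPoly s t E = 0 := by
    by_contra hne
    rw [map_prod] at hPx
    have := Finset.prod_ne_zero_iff.1 hPx (s, t, E) (Finset.mem_univ _)
    rw [if_neg hne] at this
    exact this (eval_diffPoly_eq_zero hD hx h)
  obtain ⟨n, hn⟩ := hD.1 t
  rw [phiE_eq_of_diffPoly_eq_zero hst hzero hm hn, phiE_eq_of_diffPoly_eq_zero hst hzero hm' hn]

omit [DecidableEq S] in
lemma simI_equivalence (D : MDP S A L) (α : S → A → ℝ) (i : ℕ) : Equivalence (D.simI α i) := by
  cases i with
  | zero => exact ⟨fun _ => rfl, fun h => h.symm, fun h h' => h.trans h'⟩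
  | succ i =>
    exact ⟨fun _ => ⟨rfl, fun _ _ => rfl⟩,
      fun h => ⟨h.1.symm, fun E hE => (h.2 E hE).symm⟩,
      fun h h' => ⟨h.1.trans h'.1, fun E hE => (h.2 E hE).trans (h'.2 E hE)⟩⟩

omit [Fintype A] in
lemma equivX_trans {D : MDP S A L} {X : Set (Set S)} {s t u : S} (h : D.equivX X s t)
    (h' : D.equivX X t u) : D.equivX X s u := by
  refine ⟨h.1.trans h'.1, fun _ => ?_⟩
  by_cases hst : s = t
  · subst hst
    exact h'.2 ‹_›
  by_cases htu : t = u
  · subst htu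
    exact h.2 ‹_›
  exact ⟨(h.2 hst).1, (h.2 hst).2.trans (h'.2 htu).2⟩

omit [DecidableEq S] in
/-- `∼^{i+1}`-related states enter every `∼^i`-closed set with equal probability. -/
lemma tauE_eq_of_simI_succ {D : MDP S A L} {α : S → A → ℝ} {i : ℕ} {s t : S}
    (h : D.simI α (i + 1) s t) {E : Set S} (hE : ∀ u ∈ E, ∀ v, D.simI α i u v → v ∈ E) :
    D.tauE α s E = D.tauE α t E := by
  classical
  let r : Setoid S := ⟨D.simI α i, D.simI_equivalence α i⟩
  have key : ∀ w, D.tauE α w E = ∑ q : Quotient r,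
      if q.out ∈ E then D.tauE α w {v | D.simI α i q.out v} else 0 := by
    intro w
    unfold tauE
    rw [← Finset.sum_fiberwise Finset.univ (Quotient.mk r)]
    refine Finset.sum_congr rfl fun q _ => ?_
    have hmem : ∀ v, Quotient.mk r v = q ↔ D.simI α i q.out v := by
      intro v
      rw [eq_comm, ← Quotient.out_eq q, Quotient.eq, Quotient.out_eq]
      exact Iff.rfl
    rw [Finset.sum_filter]
    split_ifs with hq
    · refine Finset.sum_congr rfl fun v _ => ?_
      by_cases hv : D.simI α i q.out v
      · simp [hmem, hv, hE _ hq v hv]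
      · simp [hmem, hv]
    · refine Finset.sum_eq_zero fun v _ => ?_
      by_cases hv : D.simI α i q.out v
      · have : v ∉ E := fun hvE => hq (hE v hvE _ ((D.simI_equivalence α i).symm hv))
        simp [this]
      · simp [hmem, hv]
  rw [key, key]
  refine Finset.sum_congr rfl fun q _ => ?_
  rw [h.2 _ ⟨q.out, rfl⟩]

omit [DecidableEq S] in
lemma equivX_of_tauE_eq {D : MDP S A L} (hD : D.IsValid) {α : S → A → ℝ} (hα : D.IsStrategy α)
    (hsep : D.IsSeparating α) {X : Set (Set S)} {s t : S} (hl : D.label s = D.label t)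
    (h : ∀ E ∈ X, D.tauE α s E = D.tauE α t E) : D.equivX X s t := by
  refine ⟨hl, fun hst => ?_⟩
  have phiSet_eq : ∀ s t, s ≠ t → (∀ E ∈ X, D.tauE α s E = D.tauE α t E) →
      D.phiSet X s = {fun E => D.tauE α s E.1} := by
    intro s t hst h
    have hvec : ∀ m, (D.phi s m).isSome → D.phiVec X s m = fun E => D.tauE α s E.1 :=
      fun m hm => funext fun E =>
        (tauE_eq_phiE hα fun m' hm' => hsep s t E hst (h E E.2) m' m hm' hm).symm
    obtain ⟨m, hm⟩ := hD.1 s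
    ext v
    constructor
    · rintro ⟨m', hm', rfl⟩
      exact hvec m' hm'
    · rintro rfl
      exact ⟨m, hm, (hvec m hm).symm⟩
  rw [phiSet_eq s t hst h, phiSet_eq t s hst.symm fun E hE => (h E hE).symm]
  exact ⟨⟨_, rfl⟩, congrArg _ (funext fun E => h E E.2)⟩

lemma equivX_of_simI {D : MDP S A L} (hD : D.IsValid) {α : S → A → ℝ} (hα : D.IsStrategy α)
    (hsep : D.IsSeparating α) (i : ℕ) :
    ∀ s t, D.simI α i s t → D.equivX (D.partseq i) s t := by
  induction i with
  | zero =>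
    refine fun s t h => equivX_of_tauE_eq hD hα hsep h ?_
    rintro E rfl
    obtain ⟨m, hm⟩ := hD.1 s
    obtain ⟨n, hn⟩ := hD.1 t
    rw [tauE_eq_phiE hα fun m' hm' => (phiE_univ hD hm').trans (phiE_univ hD hm).symm,
      tauE_eq_phiE hα fun m' hm' => (phiE_univ hD hm').trans (phiE_univ hD hn).symm,
      phiE_univ hD hm, phiE_univ hD hn]
  | succ i ih =>
    refine fun s t h => equivX_of_tauE_eq hD hα hsep h.1 ?_
    rintro E ⟨u, rfl⟩
    exact tauE_eq_of_simI_succ h fun v hv w hvw => equivX_trans hv (ih v w hvw)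

/-- for every `i ≤ |S|` there is a partial memoryless strategy `α'_i`
such that `∼^i_{D(α)} ⊆ ≡_{X_i}` for every memoryless strategy `α ⊒ α'_i`. -/
theorem exists_partialStrategy_simI_subset_equivX
    (D : MDP S A L) (hD : D.IsValid) (i : ℕ) (hi : i ≤ Fintype.card S) :
    ∃ α' : S → Option (A → ℝ), D.IsPartialStrategy α' ∧
      ∀ α, D.IsStrategy α → Compatible α α' →
        ∀ s t, D.simI α i s t → D.equivX (D.partseq i) s t := by
  obtain ⟨β, hβ, hsep⟩ := exists_isSeparating hD
  refine ⟨fun s => some (β s), ?_, fun α hα hc => ?_⟩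
  · rintro s d ⟨⟩
    exact hβ s
  · obtain rfl : α = β := funext fun s => hc s (β s) rfl
    exact equivX_of_simI hD hα hsep i

end MDP
end
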